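/- Let (A,≺,≻,α) be a Hom-Leibniz dendriform algebra over a field K and (l≺, r≺, l≻, r≻, β, V) a bimodule of it. Let α': A→A be a morphism of (A,≺,≻,α) (so α' preserves ≺ and ≻ and commutes with α), and let β': V→V be a linear map commuting with β such that β'∘l≺(x) = l≺(α'(x))∘β', β'∘r≺(x) = r≺(α'(x))∘β', β'∘l≻(x) = l≻(α'(x))∘β' and β'∘r≻(x) = r≻(α'(x))∘β' for all x ∈ A. Define l̃≺(x) = l≺(α'(x))∘β', r̃≺(x) = r≺(α'(x))∘β', l̃≻(x) = l≻(α'(x))∘β', r̃≻(x) = r≻(α'(x))∘β'. Then (l̃≺, r̃≺, l̃≻, r̃≻, β∘β', V) is a bimodule of the twisted Hom-Leibniz dendriform algebra A_{α'} = (A, ≺_{α'}, ≻_{α'}, α∘α'), where x ≺_{α'} y = α'(x≺y) and x ≻_{α'} y = α'(x≻y). -/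

import Mathlib

/-- A Hom-Leibniz dendriform algebra `(A, ≺, ≻, α)`, with `p = ≺` and `s = ≻`
and `[x,y] = x≺y + x≻y`. -/
def HomLeibnizDendriform {K A : Type*} [Field K] [AddCommGroup A] [Module K A]
    (p s : A →ₗ[K] A →ₗ[K] A) (α : A →ₗ[K] A) : Prop :=
  (∀ x y z : A, s (p x y + s x y) (α z) = s (α x) (s y z) - s (α y) (s x z)) ∧
  (∀ x y z : A, s (α x) (p y z) = p (s x y) (α z) + p (α y) (p x z + s x z)) ∧
  (∀ x y z : A, p (α x) (p y z + s y z) = p (p x y) (α z) + s (α y) (p x z))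
/-- A bimodule `(l≺, r≺, l≻, r≻, β, V)` of a Hom-Leibniz dendriform algebra
`(A, ≺, ≻, α)` (here `p = ≺`, `s = ≻`, `lp = l≺`, `rp = r≺`, `ls = l≻`,
`rs = r≻`). -/
def HomLeibnizDendriformBimodule {K A V : Type*} [Field K]
    [AddCommGroup A] [Module K A] [AddCommGroup V] [Module K V]
    (p s : A →ₗ[K] A →ₗ[K] A) (α : A →ₗ[K] A)
    (lp rp ls rs : A →ₗ[K] V →ₗ[K] V) (β : V →ₗ[K] V) : Prop :=
  (∀ x y v, ls (p x y + s x y) (β v) = ls (α x) (ls y v) - ls (α y) (ls x v)) ∧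
  (∀ x y v, rs (α y) (lp x v + ls x v) = ls (α x) (rs y v) - rs (s x y) (β v)) ∧
  (∀ x y v, rs (α y) (rp x v + rs x v) = rs (s x y) (β v) - ls (α x) (rs y v)) ∧
  (∀ x y v, ls (α x) (lp y v) = lp (s x y) (β v) + lp (α y) (lp x v + ls x v)) ∧
  (∀ x y v, ls (α x) (rp y v) = rp (α y) (ls x v) + rp (p x y + s x y) (β v)) ∧
  (∀ x y v, rs (p x y) (β v) = rp (α y) (rs x v) + lp (α x) (rp y v + rs y v)) ∧
  (∀ x y v, lp (α x) (lp y v + ls y v) = lp (p x y) (β v) + ls (α y) (lp x v)) ∧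
  (∀ x y v, lp (α x) (rp y v + rs y v) = rp (α y) (lp x v) + rs (p x y) (β v)) ∧
  (∀ x y v, rp (p x y + s x y) (β v) = rp (α y) (rp x v) + ls (α x) (rp y v)) ∧
  (∀ x v, β (lp x v) = lp (α x) (β v)) ∧
  (∀ x v, β (rp x v) = rp (α x) (β v)) ∧
  (∀ x v, β (ls x v) = ls (α x) (β v)) ∧
  (∀ x v, β (rs x v) = rs (α x) (β v))

/-- The twisted action `x ↦ l(α'(x)) ∘ β'`, bundled as a linear map. -/
def twistAction {K A V : Type*} [Field K] [AddCommGroup A] [Module K A]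
    [AddCommGroup V] [Module K V]
    (l : A →ₗ[K] V →ₗ[K] V) (α' : A →ₗ[K] A) (β' : V →ₗ[K] V) :
    A →ₗ[K] V →ₗ[K] V :=
  ((LinearMap.llcomp K V V V).flip β').comp (l.comp α')

@[simp]
theorem twistAction_apply {K A V : Type*} [Field K] [AddCommGroup A] [Module K A]
    [AddCommGroup V] [Module K V]
    (l : A →ₗ[K] V →ₗ[K] V) (α' : A →ₗ[K] A) (β' : V →ₗ[K] V) (x : A) (v : V) :
    twistAction l α' β' x v = l (α' x) (β' v) :=
  rfl

/-- twisting a bimodule of a Hom-Leibniz dendriform algebra by a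
morphism `α'` and a compatible map `β'` yields a bimodule of the twisted
Hom-Leibniz dendriform algebra `(A, ≺_{α'}, ≻_{α'}, α∘α')`. -/
theorem homLeibnizDendriform_bimodule_twist
    {K A V : Type*} [Field K] [AddCommGroup A] [Module K A]
    [AddCommGroup V] [Module K V]
    (p s : A →ₗ[K] A →ₗ[K] A) (α : A →ₗ[K] A)
    (lp rp ls rs : A →ₗ[K] V →ₗ[K] V) (β : V →ₗ[K] V)
    (hA : HomLeibnizDendriform p s α)
    (hV : HomLeibnizDendriformBimodule p s α lp rp ls rs β)
    (α' : A →ₗ[K] A)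
    (hα'p : ∀ x y : A, α' (p x y) = p (α' x) (α' y))
    (hα's : ∀ x y : A, α' (s x y) = s (α' x) (α' y))
    (hα'α : ∀ x : A, α' (α x) = α (α' x))
    (β' : V →ₗ[K] V)
    (hβ'β : ∀ v : V, β' (β v) = β (β' v))
    (hβ'lp : ∀ (x : A) (v : V), β' (lp x v) = lp (α' x) (β' v))
    (hβ'rp : ∀ (x : A) (v : V), β' (rp x v) = rp (α' x) (β' v))
    (hβ'ls : ∀ (x : A) (v : V), β' (ls x v) = ls (α' x) (β' v))
    (hβ'rs : ∀ (x : A) (v : V), β' (rs x v) = rs (α' x) (β' v)) :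
    HomLeibnizDendriformBimodule (p.compr₂ α') (s.compr₂ α') (α ∘ₗ α')
      (twistAction lp α' β') (twistAction rp α' β')
      (twistAction ls α' β') (twistAction rs α' β') (β ∘ₗ β') := by
  obtain ⟨h1, h2, h3, h4, h5, h6, h7, h8, h9, h10, h11, h12, h13⟩ := hV
  refine ⟨fun x y v => ?_, fun x y v => ?_, fun x y v => ?_, fun x y v => ?_,
    fun x y v => ?_, fun x y v => ?_, fun x y v => ?_, fun x y v => ?_,
    fun x y v => ?_, fun x v => ?_, fun x v => ?_, fun x v => ?_, fun x v => ?_⟩ <;>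
  simp only [twistAction_apply, LinearMap.compr₂_apply, LinearMap.comp_apply, map_add,
    LinearMap.add_apply, hα'p, hα's, hα'α, hβ'β, hβ'lp, hβ'rp, hβ'ls, hβ'rs]
  · simpa using h1 (α' (α' x)) (α' (α' y)) (β' (β' v))
  · simpa using h2 (α' (α' x)) (α' (α' y)) (β' (β' v))
  · simpa using h3 (α' (α' x)) (α' (α' y)) (β' (β' v))
  · simpa using h4 (α' (α' x)) (α' (α' y)) (β' (β' v))
  · simpa using h5 (α' (α' x)) (α' (α' y)) (β' (β' v))
  · simpa using h6 (α' (α' x)) (α' (α' y)) (β' (β' v))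
  · simpa using h7 (α' (α' x)) (α' (α' y)) (β' (β' v))
  · simpa using h8 (α' (α' x)) (α' (α' y)) (β' (β' v))
  · simpa using h9 (α' (α' x)) (α' (α' y)) (β' (β' v))
  · exact h10 (α' (α' x)) (β' (β' v))
  · exact h11 (α' (α' x)) (β' (β' v))
  · exact h12 (α' (α' x)) (β' (β' v))
  · exact h13 (α' (α' x)) (β' (β' v))
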